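/- Fix r ∈ ℕ* and a real constant c > 0 such that η(C_m^r) ≤ c(m−1)+1 for every m ∈ ℕ*. Then for every finite abelian group G of rank r and exponent n, one has ρ(G) ≤ c · Σ_{d ∣ n} (P^−(d) − 1)/d. -/

import Mathlib

open Multiset Finset

/-- The cross number of a sequence (multiset) over an additive group:
    the sum of the reciprocals of the orders of its elements. -/
noncomputable def crossNum {G : Type*} [AddCommGroup G] (S : Multiset G) : ℝ :=
  (S.map fun g => (1 : ℝ) / (addOrderOf g : ℝ)).sum

/-- A tiny zero-sum sequence: non-empty, zero sum, cross number at most 1. -/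
def IsTinyZS {G : Type*} [AddCommGroup G] (S' : Multiset G) : Prop :=
  S' ≠ 0 ∧ S'.sum = 0 ∧ crossNum S' ≤ 1

/-- `tC G` : the smallest `t ≥ 1` such that every sequence over `G` of length `≥ t`
    contains a tiny zero-sum subsequence. -/
noncomputable def tC (G : Type*) [AddCommGroup G] : ℕ :=
  sInf {t : ℕ | 0 < t ∧ ∀ S : Multiset G, t ≤ Multiset.card S → ∃ S' ≤ S, IsTinyZS S'}

/-- `etaC G` : the smallest `t ≥ 1` such that every sequence over `G` of length `≥ t`
    contains a non-empty zero-sum subsequence of length at most `exp(G)`. -/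
noncomputable def etaC (G : Type*) [AddCommGroup G] : ℕ :=
  sInf {t : ℕ | 0 < t ∧ ∀ S : Multiset G, t ≤ Multiset.card S →
    ∃ S' ≤ S, S' ≠ 0 ∧ S'.sum = 0 ∧ Multiset.card S' ≤ AddMonoid.exponent G}

/-- `etaDD G d' d` : the smallest `t ≥ 1` such that every sequence over
    `G_d = {x : G | d • x = 0}` of length `≥ t` contains a non-empty subsequence of length
    at most `d'` whose sum lies in `G_{d/d'}`. -/
noncomputable def etaDD (G : Type*) [AddCommGroup G] (d' d : ℕ) : ℕ :=
  sInf {t : ℕ | 0 < t ∧ ∀ S : Multiset G, (∀ g ∈ S, d • g = 0) → t ≤ Multiset.card S →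
    ∃ S' ≤ S, S' ≠ 0 ∧ Multiset.card S' ≤ d' ∧ (d / d') • S'.sum = 0}

/-- `rhoC G` : the maximum of the cross numbers of sequences over `G` containing
    no tiny zero-sum subsequence. -/
noncomputable def rhoC (G : Type*) [AddCommGroup G] : ℝ :=
  sSup {x : ℝ | ∃ S : Multiset G, (¬ ∃ S' ≤ S, IsTinyZS S') ∧ crossNum S = x}

/-- `maxPF n = P⁺(n)`, the greatest prime divisor of `n`, with `P⁺(1) = 1`. -/
def maxPF (n : ℕ) : ℕ := if n = 1 then 1 else n.primeFactors.sup id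

/-- `G` is a finite abelian group of rank `r`, i.e. `G ≅ C_{n₁} ⊕ ⋯ ⊕ C_{n_r}` with
    `1 < n₁ ∣ ⋯ ∣ n_r`. -/
def HasRank (G : Type*) [AddCommGroup G] (r : ℕ) : Prop :=
  ∃ n : Fin r → ℕ, (∀ i, 1 < n i) ∧ (∀ i j : Fin r, i ≤ j → n i ∣ n j) ∧
    Nonempty (G ≃+ ((i : Fin r) → ZMod (n i)))


theorem exists_shortZeroSum_of_etaC_le (A : Type*) [AddCommGroup A] [Finite A] (S : Multiset A)
    (hS : etaC A ≤ Multiset.card S) :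
    ∃ S' ≤ S, S' ≠ 0 ∧ S'.sum = 0 ∧ Multiset.card S' ≤ AddMonoid.exponent A := by
  classical
  have := Fintype.ofFinite A
  have he : AddMonoid.exponent A ≠ 0 := AddMonoid.exponent_ne_zero_of_finite
  refine (Nat.sInf_mem (s := {t : ℕ | 0 < t ∧ ∀ S : Multiset A, t ≤ Multiset.card S →
    ∃ S' ≤ S, S' ≠ 0 ∧ S'.sum = 0 ∧ Multiset.card S' ≤ AddMonoid.exponent A})
    ⟨Fintype.card A * AddMonoid.exponent A + 1, Nat.succ_pos _, fun T hT => ?_⟩).2 S hS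
  obtain ⟨a, ha⟩ : ∃ a, AddMonoid.exponent A ≤ T.count a := by
    by_contra! h
    have h1 : Multiset.card T ≤ ∑ _a : A, AddMonoid.exponent A := by
      rw [← Multiset.sum_count_eq_card (s := Finset.univ) (fun a _ => Finset.mem_univ a)]
      exact Finset.sum_le_sum fun a _ => (h a).le
    simp only [Finset.sum_const, Finset.card_univ, smul_eq_mul] at h1
    omega
  refine ⟨Multiset.replicate (AddMonoid.exponent A) a, Multiset.le_count_iff_replicate_le.1 ha,
    fun h => he ?_, ?_, by simp⟩
  · simpa using congrArg Multiset.card h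
  · rw [Multiset.sum_replicate, AddMonoid.exponent_nsmul_eq_zero]

theorem ZMod.exists_injective_torsion_hom (m p : ℕ) (hp : p.Prime) :
    ∃ f : (nsmulAddMonoidHom p : ZMod m →+ ZMod m).ker →+ ZMod p, Function.Injective f := by
  have hcyc : IsAddCyclic (nsmulAddMonoidHom p : ZMod m →+ ZMod m).ker := inferInstance
  have hd : Nat.card (nsmulAddMonoidHom p : ZMod m →+ ZMod m).ker ∣ p := by
    rw [← IsAddCyclic.exponent_eq_card]
    refine AddMonoid.exponent_dvd_of_forall_nsmul_eq_zero fun x => Subtype.ext ?_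
    exact x.2
  rcases (Nat.dvd_prime hp).1 hd with h | h
  · have := (Nat.card_eq_one_iff_unique.1 h).1
    exact ⟨0, Function.injective_of_subsingleton _⟩
  · have e := zmodAddCyclicAddEquiv hcyc
    rw [h] at e
    exact ⟨e.symm, e.symm.injective⟩

theorem HasRank.exists_injective_torsion_hom {G : Type*} [AddCommGroup G] {r : ℕ} (hG : HasRank G r)
    {p : ℕ} (hp : p.Prime) :
    ∃ f : (nsmulAddMonoidHom p : G →+ G).ker →+ (Fin r → ZMod p), Function.Injective f := by
  obtain ⟨n, -, -, ⟨e⟩⟩ := hG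
  choose f hf using fun i => ZMod.exists_injective_torsion_hom (n i) p hp
  have hmem (x : (nsmulAddMonoidHom p : G →+ G).ker) (i : Fin r) :
      e x i ∈ (nsmulAddMonoidHom p : ZMod (n i) →+ ZMod (n i)).ker := by
    have hx : p • (x : G) = 0 := x.2
    change p • e x i = 0
    rw [← Pi.smul_apply, ← _root_.map_nsmul, hx, _root_.map_zero, Pi.zero_apply]
  refine ⟨AddMonoidHom.mk' (fun x i => f i ⟨e x i, hmem x i⟩) fun x y => ?_, fun x y h => ?_⟩
  · funext i
    rw [Pi.add_apply, ← _root_.map_add]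
    exact congrArg (f i) (Subtype.ext (by simp))
  · refine Subtype.ext (e.injective (funext fun i => ?_))
    exact congrArg Subtype.val (hf i (congrFun h i))

theorem Multiset.exists_le_map_eq_of_le_map {α β : Type*} (f : α → β) {s : Multiset α}
    {t : Multiset β} (h : t ≤ s.map f) : ∃ s' ≤ s, s'.map f = t := by
  classical
  induction s using Multiset.induction_on generalizing t with
  | empty => exact ⟨0, le_rfl, (Multiset.le_zero.1 h).symm⟩
  | cons a s ih =>
    rw [Multiset.map_cons] at h
    by_cases ha : f a ∈ t
    · obtain ⟨u, rfl⟩ := Multiset.exists_cons_of_mem ha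
      obtain ⟨s', hs, rfl⟩ := ih ((Multiset.cons_le_cons_iff _).1 h)
      exact ⟨a ::ₘ s', Multiset.cons_le_cons _ hs, by simp⟩
    · obtain ⟨s', hs, rfl⟩ := ih ((Multiset.le_cons_of_notMem ha).1 h)
      exact ⟨s', hs.trans (Multiset.le_cons_self _ _), rfl⟩

theorem HasRank.exists_short_subsequence {G : Type*} [AddCommGroup G] {r : ℕ} (hG : HasRank G r)
    {d p : ℕ} (hp : p.Prime) (hpd : p ∣ d) (S : Multiset G) (hS : ∀ g ∈ S, d • g = 0)
    (hcard : etaC (Fin r → ZMod p) ≤ Multiset.card S) :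
    ∃ S' ≤ S, S' ≠ 0 ∧ Multiset.card S' ≤ p ∧ (d / p) • S'.sum = 0 := by
  have := Fact.mk hp
  obtain ⟨f, hf⟩ := hG.exists_injective_torsion_hom hp
  let K := (nsmulAddMonoidHom d : G →+ G).ker
  have hmem (x : K) : (d / p) • (x : G) ∈ (nsmulAddMonoidHom p : G →+ G).ker := by
    have hx : d • (x : G) = 0 := x.2
    change p • (d / p) • (x : G) = 0
    rw [← mul_nsmul, Nat.div_mul_cancel hpd, hx]
  let ψ : K →+ (Fin r → ZMod p) :=
    f.comp (AddMonoidHom.mk' (fun x => ⟨(d / p) • (x : G), hmem x⟩) fun x y =>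
      Subtype.ext (by simp))
  have hψ (x : K) (hx : ψ x = 0) : (d / p) • (x : G) = 0 :=
    congrArg Subtype.val (hf (hx.trans (_root_.map_zero f).symm))
  obtain ⟨T, rfl⟩ : ∃ T : Multiset K, T.map (↑) = S := by
    lift S to Multiset K using hS
    exact ⟨S, rfl⟩
  obtain ⟨U, hU, hU0, hUs, hUc⟩ := exists_shortZeroSum_of_etaC_le _ (T.map ψ) (by simpa using hcard)
  obtain ⟨T', hT', rfl⟩ := Multiset.exists_le_map_eq_of_le_map ψ hU
  refine ⟨T'.map (↑), Multiset.map_le_map hT', fun h => hU0 ?_, ?_, ?_⟩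
  · rw [Multiset.map_eq_zero.1 h, Multiset.map_zero]
  · rw [Multiset.card_map] at hUc ⊢
    refine hUc.trans (Nat.le_of_dvd hp.pos ?_)
    exact AddMonoid.exponent_dvd_of_forall_nsmul_eq_zero fun x => funext fun i => by simp
  · have hsum : (T'.map ((↑) : K → G)).sum = (T'.sum : K) := (map_multiset_sum K.subtype T').symm
    rw [hsum]
    exact hψ _ (by rw [map_multiset_sum, hUs])

theorem crossNum_add {G : Type*} [AddCommGroup G] (S T : Multiset G) :
    crossNum (S + T) = crossNum S + crossNum T := by
  simp [crossNum]

theorem crossNum_singleton {G : Type*} [AddCommGroup G] (g : G) :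
    crossNum {g} = 1 / (addOrderOf g : ℝ) := by
  simp [crossNum]

theorem crossNum_eq_of_forall_addOrderOf_eq {G : Type*} [AddCommGroup G] {S : Multiset G} {d : ℕ}
    (hS : ∀ g ∈ S, addOrderOf g = d) : crossNum S = Multiset.card S / (d : ℝ) := by
  rw [crossNum, Multiset.map_congr rfl fun g hg => by rw [hS g hg], Multiset.map_const',
    Multiset.sum_replicate, nsmul_eq_mul, mul_one_div]

theorem crossNum_eq_sum_divisors {G : Type*} [AddCommGroup G] {n : ℕ} (hn0 : n ≠ 0)
    (hn : AddMonoid.exponent G = n) (S : Multiset G) :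
    crossNum S = ∑ d ∈ n.divisors,
      (Multiset.card (S.filter fun g => addOrderOf g = d) : ℝ) / (d : ℝ) := by
  induction S using Multiset.induction_on with
  | empty => simp [crossNum]
  | cons a S ih =>
    have ha : addOrderOf a ∈ n.divisors :=
      Nat.mem_divisors.2 ⟨hn ▸ AddMonoid.addOrder_dvd_exponent a, hn0⟩
    have hcard (d : ℕ) : (Multiset.card ((a ::ₘ S).filter fun g => addOrderOf g = d) : ℝ) / d =
        (if addOrderOf a = d then 1 / (d : ℝ) else 0) +
          (Multiset.card (S.filter fun g => addOrderOf g = d) : ℝ) / (d : ℝ) := by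
      by_cases h : addOrderOf a = d <;> simp [h, add_div, add_comm]
    rw [← Multiset.singleton_add, crossNum_add, Multiset.singleton_add, crossNum_singleton, ih,
      Finset.sum_congr rfl fun d _ => hcard d, Finset.sum_add_distrib, Finset.sum_ite_eq,
      if_pos ha]

/-- Replacing a subsequence by its sum creates no tiny zero-sum subsequence, as long as the cross
number does not decrease. -/
theorem not_exists_isTinyZS_cons_sum {G : Type*} [AddCommGroup G] {R S' : Multiset G}
    (hS' : S' ≠ 0) (hk : crossNum S' ≤ crossNum {S'.sum})
    (h : ¬ ∃ T ≤ R + S', IsTinyZS T) : ¬ ∃ T ≤ R + {S'.sum}, IsTinyZS T := by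
  classical
  rintro ⟨T, hT, hT0, hTs, hTk⟩
  refine h ?_
  by_cases hmem : S'.sum ∈ T
  · obtain ⟨U, rfl⟩ := Multiset.exists_cons_of_mem hmem
    rw [add_comm, Multiset.singleton_add, Multiset.cons_le_cons_iff] at hT
    refine ⟨U + S', by gcongr, fun h0 => hS' ?_, ?_, ?_⟩
    · exact (add_eq_zero.1 h0).2
    · rw [Multiset.sum_add, add_comm, ← hTs, Multiset.sum_cons]
    · rw [← Multiset.singleton_add, crossNum_add] at hTk
      rw [crossNum_add]
      linarith
  · rw [add_comm, Multiset.singleton_add, Multiset.le_cons_of_notMem hmem] at hT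
    exact ⟨T, hT.trans (Multiset.le_add_right _ _), hT0, hTs, hTk⟩

theorem crossNum_le_of_not_exists_isTinyZS {r : ℕ} {c : ℝ}
    (hc : ∀ m : ℕ, 0 < m → (etaC (Fin r → ZMod m) : ℝ) ≤ c * ((m : ℝ) - 1) + 1)
    {G : Type*} [AddCommGroup G] [Finite G] (hG : HasRank G r) {n : ℕ}
    (hn : AddMonoid.exponent G = n) (S : Multiset G) (hS : ¬ ∃ S' ≤ S, IsTinyZS S') :
    crossNum S ≤ c * ∑ d ∈ n.divisors, ((d.minFac : ℝ) - 1) / (d : ℝ) := by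
  classical
  have hn0 : n ≠ 0 := hn ▸ AddMonoid.exponent_ne_zero_of_finite
  induction hl : Multiset.card S using Nat.strong_induction_on generalizing S with
  | _ l ih =>
    subst hl
    by_cases hbig : ∃ d, 1 < d ∧
        etaC (Fin r → ZMod d.minFac) ≤ Multiset.card (S.filter fun g => addOrderOf g = d)
    · obtain ⟨d, hd, hcard⟩ := hbig
      have hp : d.minFac.Prime := Nat.minFac_prime hd.ne'
      have hpd : d.minFac ∣ d := d.minFac_dvd
      have hd0 : (0 : ℝ) < d := by exact_mod_cast zero_lt_one.trans hd
      have hq0 : 0 < d / d.minFac := Nat.div_pos (Nat.minFac_le (by omega)) hp.pos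
      obtain ⟨S', hle, hS'0, hS'c, hS's⟩ := hG.exists_short_subsequence hp hpd
        (S.filter fun g => addOrderOf g = d)
        (fun g hg => (Multiset.mem_filter.1 hg).2 ▸ addOrderOf_nsmul_eq_zero g) hcard
      have hord : ∀ g ∈ S', addOrderOf g = d := fun g hg =>
        (Multiset.mem_filter.1 (Multiset.mem_of_le hle hg)).2
      obtain ⟨R, rfl⟩ : ∃ R, S = R + S' := by
        obtain ⟨R, hR⟩ := Multiset.le_iff_exists_add.1 (hle.trans (Multiset.filter_le _ S))
        exact ⟨R, hR.trans (add_comm _ _)⟩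
      have hk : crossNum S' ≤ crossNum {S'.sum} := by
        have hle : addOrderOf S'.sum ≤ d / d.minFac :=
          Nat.le_of_dvd hq0 (addOrderOf_dvd_of_nsmul_eq_zero hS's)
        have hpos : (0 : ℝ) < addOrderOf S'.sum := by exact_mod_cast addOrderOf_pos S'.sum
        have hmul : addOrderOf S'.sum * Multiset.card S' ≤ d :=
          (Nat.mul_le_mul hle hS'c).trans (Nat.div_mul_cancel hpd).le
        rw [crossNum_eq_of_forall_addOrderOf_eq hord, crossNum_singleton,
          div_le_div_iff₀ hd0 hpos, one_mul, mul_comm]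
        exact_mod_cast hmul
      have hcard2 : 1 < Multiset.card S' := by
        have h0 : Multiset.card S' ≠ 0 := fun h => hS'0 (Multiset.card_eq_zero.1 h)
        have h1 : Multiset.card S' ≠ 1 := fun h => by
          obtain ⟨g, rfl⟩ := Multiset.card_eq_one.1 h
          rw [Multiset.sum_singleton] at hS's
          have hdvd := addOrderOf_dvd_of_nsmul_eq_zero hS's
          rw [hord g (Multiset.mem_singleton_self g)] at hdvd
          exact absurd (Nat.le_of_dvd hq0 hdvd)
            (not_le.2 (Nat.div_lt_self (by omega) hp.one_lt))
        omega
      have := ih _ (by simp only [Multiset.card_add, Multiset.card_singleton]; omega) _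
        (not_exists_isTinyZS_cons_sum hS'0 hk hS) rfl
      rw [crossNum_add] at this ⊢
      linarith
    · push Not at hbig
      rw [crossNum_eq_sum_divisors hn0 hn, Finset.mul_sum]
      refine Finset.sum_le_sum fun d hd => ?_
      rw [← mul_div_assoc]
      refine div_le_div_of_nonneg_right ?_ (Nat.cast_nonneg d)
      have hd0 : 0 < d := Nat.pos_of_mem_divisors hd
      rcases (show 1 ≤ d from hd0).eq_or_lt with rfl | hd1
      · have : S.filter (fun g => addOrderOf g = 1) = 0 := by
          refine Multiset.filter_eq_nil.2 fun g hg h1 => hS ⟨{g}, ?_, ?_, ?_, ?_⟩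
          · exact Multiset.singleton_le.2 hg
          · exact Multiset.singleton_ne_zero g
          · rw [Multiset.sum_singleton, AddMonoid.addOrderOf_eq_one_iff.1 h1]
          · rw [crossNum_singleton, h1]; norm_num
        rw [this]
        simp
      · have h1 := hc d.minFac d.minFac_pos
        have h2 : (Multiset.card (S.filter fun g => addOrderOf g = d) : ℝ) + 1 ≤
            etaC (Fin r → ZMod d.minFac) := by exact_mod_cast hbig d hd1
        linarith

/-- If `η(C_m^r) ≤ c(m-1)+1` for all `m ≥ 1`, then for every finite abelian group `G`
of rank `r` and exponent `n`, `ρ(G) ≤ c ⬝ ∑_{d ∣ n} (P⁻(d) - 1)/d`. -/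
theorem stmt8 (r : ℕ) (hr : 0 < r) (c : ℝ) (hc0 : 0 < c)
    (hc : ∀ m : ℕ, 0 < m → (etaC (Fin r → ZMod m) : ℝ) ≤ c * ((m : ℝ) - 1) + 1)
    (G : Type*) [AddCommGroup G] [Fintype G] (hG : HasRank G r)
    (n : ℕ) (hn : AddMonoid.exponent G = n) :
    rhoC G ≤ c * ∑ d ∈ n.divisors, ((d.minFac : ℝ) - 1) / (d : ℝ) := by
  refine csSup_le ⟨0, 0, ?_, by simp [crossNum]⟩ ?_
  · rintro ⟨S', hS', h0, -⟩
    exact h0 (Multiset.le_zero.1 hS')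
  · rintro x ⟨S, hS, rfl⟩
    exact crossNum_le_of_not_exists_isTinyZS hc hG hn S hS
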